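/- Let R be a right-linear overlay TRS and s a term that is terminating w.r.t. R. For every term t, if s →_R* t and t is a normal form of R, then s i→_R* t. -/

import Mathlib

namespace RWS

/-- First-order terms over a signature `F` (function symbols of arbitrary arity,
realized by lists of arguments) and variables `V`. -/
inductive Term (F V : Type) : Type
  | var : V → Term F V
  | app : F → List (Term F V) → Term F V

namespace Term

variable {F V : Type}

/-- `t` is a variable. -/
def IsVar : Term F V → Prop
  | var _ => True
  | app _ _ => False

/-- Application of a substitution (a map from variables to terms) to a term. -/
def subst (σ : V → Term F V) : Term F V → Term F V
  | var x => σ x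
  | app f ts => app f (ts.attach.map fun t => t.1.subst σ)
decreasing_by
  simp_wf
  have := List.sizeOf_lt_of_mem t.2
  omega

/-- The list of variable occurrences of a term. -/
def varOccs : Term F V → List V
  | var x => [x]
  | app _ ts => (ts.attach.map fun t => t.1.varOccs).flatten
decreasing_by
  simp_wf
  have := List.sizeOf_lt_of_mem t.2
  omega

/-- A term is linear if no variable occurs in it more than once. -/
def Linear (t : Term F V) : Prop := t.varOccs.Nodup

end Term

variable {F V : Type}

/-- `PSub t u` : `t` is a proper subterm of `u` (i.e. `u ▷ t`). -/
inductive PSub : Term F V → Term F V → Prop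
  | head {t f ts} : t ∈ ts → PSub t (.app f ts)
  | tail {t u f ts} : PSub t u → u ∈ ts → PSub t (.app f ts)

/-- Subterm-or-equal relation. -/
def Sub (t u : Term F V) : Prop := t = u ∨ PSub t u

/-- The rewrite relation of a set `R` of rewrite rules: contraction of a redex
at some position (root rule instance, closed under contexts). -/
inductive Rew (R : Set (Term F V × Term F V)) : Term F V → Term F V → Prop
  | root {l r : Term F V} {σ : V → Term F V} :
      (l, r) ∈ R → Rew R (l.subst σ) (r.subst σ)
  | congr {s t : Term F V} {f : F} {ts us : List (Term F V)} :
      Rew R s t → Rew R (.app f (ts ++ s :: us)) (.app f (ts ++ t :: us))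

/-- `t` is a normal form of `R`. -/
def NormalForm (R : Set (Term F V × Term F V)) (t : Term F V) : Prop :=
  ∀ u, ¬ Rew R t u

/-- Innermost rewriting: contraction of a redex all of whose proper subterms
are normal forms of `R`. -/
inductive IRew (R : Set (Term F V × Term F V)) : Term F V → Term F V → Prop
  | root {l r : Term F V} {σ : V → Term F V} :
      (l, r) ∈ R → (∀ u, PSub u (l.subst σ) → NormalForm R u) →
      IRew R (l.subst σ) (r.subst σ)
  | congr {s t : Term F V} {f : F} {ts us : List (Term F V)} :
      IRew R s t → IRew R (.app f (ts ++ s :: us)) (.app f (ts ++ t :: us))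

/-- A rewrite step at the root position (`→_{ε}`). -/
def RootStep (R : Set (Term F V × Term F V)) (s t : Term F V) : Prop :=
  ∃ l r σ, (l, r) ∈ R ∧ s = Term.subst σ l ∧ t = Term.subst σ r

/-- A rewrite step strictly below the root (`→_{>ε}`). -/
def BelowRew (R : Set (Term F V × Term F V)) (s t : Term F V) : Prop :=
  ∃ (f : F) (ts us : List (Term F V)) (a b : Term F V),
    Rew R a b ∧ s = .app f (ts ++ a :: us) ∧ t = .app f (ts ++ b :: us)

/-- An innermost rewrite step strictly below the root (`i→_{>ε}`). -/
def IBelowRew (R : Set (Term F V × Term F V)) (s t : Term F V) : Prop :=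
  ∃ (f : F) (ts us : List (Term F V)) (a b : Term F V),
    IRew R a b ∧ s = .app f (ts ++ a :: us) ∧ t = .app f (ts ++ b :: us)

/-- `R` is a term rewrite system: left-hand sides are not variables and
variables of right-hand sides occur in the corresponding left-hand sides. -/
def IsTRS (R : Set (Term F V × Term F V)) : Prop :=
  ∀ p ∈ R, ¬ p.1.IsVar ∧ ∀ x ∈ p.2.varOccs, x ∈ p.1.varOccs

/-- All right-hand sides are linear. -/
def RightLinear (R : Set (Term F V × Term F V)) : Prop :=
  ∀ p ∈ R, p.2.Linear

/-- No right-hand side is a variable. -/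
def NonCollapsing (R : Set (Term F V × Term F V)) : Prop :=
  ∀ p ∈ R, ¬ p.2.IsVar

/-- `R` has an inner-overlap: a proper non-variable subterm of some left-hand
side is unifiable (after renaming the rules apart, equivalently: some instance
of the one equals some instance of the other) with some left-hand side. -/
def InnerOverlap (R : Set (Term F V × Term F V)) : Prop :=
  ∃ l r l' r' u, (l, r) ∈ R ∧ (l', r') ∈ R ∧ PSub u l ∧ ¬ u.IsVar ∧
    ∃ σ τ : V → Term F V, u.subst σ = l'.subst τ

/-- `R` is an overlay system. -/
def Overlay (R : Set (Term F V × Term F V)) : Prop := ¬ InnerOverlap R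

/-- The term `t` is terminating w.r.t. `R`: no infinite rewrite sequence starts from `t`. -/
def Terminating (R : Set (Term F V × Term F V)) (t : Term F V) : Prop :=
  ¬ ∃ f : ℕ → Term F V, f 0 = t ∧ ∀ n, Rew R (f n) (f (n + 1))

/-- The TRS `R` is terminating: there is no infinite rewrite sequence. -/
def TerminatingTRS (R : Set (Term F V × Term F V)) : Prop :=
  ¬ ∃ f : ℕ → Term F V, ∀ n, Rew R (f n) (f (n + 1))

/-- The TRS `R` is innermost terminating: there is no infinite innermost rewrite sequence. -/
def InnermostTerminatingTRS (R : Set (Term F V × Term F V)) : Prop :=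
  ¬ ∃ f : ℕ → Term F V, ∀ n, IRew R (f n) (f (n + 1))

/-- Domain of a substitution. -/
def Dom (σ : V → Term F V) : Set V := {x | σ x ≠ .var x}

end RWS

namespace RWS

variable {F V : Type}

/-- Embedding of terms over the signature `F` into terms over the extended
signature `F ⊕ F`, where `Sum.inl f` is the original symbol `f` and
`Sum.inr f` is the fresh tuple symbol `f#`. -/
def Term.lift : Term F V → Term (F ⊕ F) V
  | .var x => .var x
  | .app f ts => .app (Sum.inl f) (ts.attach.map fun t => t.1.lift)
decreasing_by
  simp_wf
  have := List.sizeOf_lt_of_mem t.2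
  omega

/-- The TRS `R` viewed over the extended signature `F ⊕ F`. -/
def liftTRS (R : Set (Term F V × Term F V)) :
    Set (Term (F ⊕ F) V × Term (F ⊕ F) V) :=
  { p | ∃ l r, (l, r) ∈ R ∧ p = (l.lift, r.lift) }

/-- The defined symbols of `R`: root symbols of left-hand sides. -/
def DefinedSym (R : Set (Term F V × Term F V)) : Set F :=
  { f | ∃ ts r, (Term.app f ts, r) ∈ R }

/-- `t#`: the term `f(t₁,…,tₙ)` with its root replaced by the tuple symbol `f#`. -/
def Term.sharp : Term F V → Term (F ⊕ F) V
  | .var x => .var x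
  | .app f ts => .app (Sum.inr f) (ts.attach.map fun t => t.1.lift)

/-- The set of dependency pairs of `R`: rules `ℓ# → t#` where `ℓ → r ∈ R` and
`t` is a subterm of `r` whose root symbol is defined. -/
def DP (R : Set (Term F V × Term F V)) :
    Set (Term (F ⊕ F) V × Term (F ⊕ F) V) :=
  { p | ∃ l r t, (l, r) ∈ R ∧ Sub t r ∧
        (∃ g ts, t = Term.app g ts ∧ g ∈ DefinedSym R) ∧
        p = (l.sharp, t.sharp) }

/-- There is an infinite minimal `(P,R)`-chain
`t₀ →_{>ε,R}* s₀ →_{ε,P} t₁ →_{>ε,R}* s₁ →_{ε,P} t₂ ⋯` (all proper subterms of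
the `tᵢ` are terminating w.r.t. `R`). -/
def InfMinChain (P R : Set (Term F V × Term F V)) : Prop :=
  ∃ t s : ℕ → Term F V,
    (∀ i, Relation.ReflTransGen (BelowRew R) (t i) (s i)) ∧
    (∀ i, RootStep P (s i) (t (i + 1))) ∧
    (∀ i v, PSub v (t i) → Terminating R v)

/-- There is an infinite innermost minimal `(P,R)`-chain: as above, where the
below-root `R`-steps are innermost and each root `P`-step is applied to a term
all of whose proper subterms are normal forms of `R`. -/
def InfInnMinChain (P R : Set (Term F V × Term F V)) : Prop :=
  ∃ t s : ℕ → Term F V,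
    (∀ i, Relation.ReflTransGen (IBelowRew R) (t i) (s i)) ∧
    (∀ i v, PSub v (s i) → NormalForm R v) ∧
    (∀ i, RootStep P (s i) (t (i + 1))) ∧
    (∀ i v, PSub v (t i) → Terminating R v)

/-- Finite minimal `(P,R)`-chains of length `n` (number of root `P`-steps),
from the first term to the term reached right after the `n`-th root `P`-step. -/
inductive MinChainN (P R : Set (Term F V × Term F V)) :
    ℕ → Term F V → Term F V → Prop
  | refl {t : Term F V} :
      (∀ v, PSub v t → Terminating R v) → MinChainN P R 0 t t
  | step {n : ℕ} {t₀ t s t' : Term F V} :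
      MinChainN P R n t₀ t →
      Relation.ReflTransGen (BelowRew R) t s →
      RootStep P s t' →
      (∀ v, PSub v t' → Terminating R v) →
      MinChainN P R (n + 1) t₀ t'

/-- Finite innermost minimal `(P,R)`-chains of length `n`. -/
inductive InnMinChainN (P R : Set (Term F V × Term F V)) :
    ℕ → Term F V → Term F V → Prop
  | refl {t : Term F V} :
      (∀ v, PSub v t → Terminating R v) → InnMinChainN P R 0 t t
  | step {n : ℕ} {t₀ t s t' : Term F V} :
      InnMinChainN P R n t₀ t →
      Relation.ReflTransGen (IBelowRew R) t s →
      (∀ v, PSub v s → NormalForm R v) →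
      RootStep P s t' →
      (∀ v, PSub v t' → Terminating R v) →
      InnMinChainN P R (n + 1) t₀ t'

end RWS

namespace RWS

variable {F V : Type} {R : Set (Term F V × Term F V)}

open Relation

theorem Term.subst_app (σ : V → Term F V) (f : F) (ts : List (Term F V)) :
    (Term.app f ts).subst σ = .app f (ts.map (Term.subst σ)) := by
  rw [Term.subst]
  simp

theorem Term.varOccs_app (f : F) (ts : List (Term F V)) :
    (Term.app f ts).varOccs = ts.flatMap Term.varOccs := by
  rw [Term.varOccs]
  simp [List.flatMap]

theorem Term.structural_induction {P : Term F V → Prop} (hvar : ∀ x, P (.var x))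
    (happ : ∀ f ts, (∀ t ∈ ts, P t) → P (.app f ts)) : ∀ t, P t
  | .var x => hvar x
  | .app f ts => happ f ts fun t _ => Term.structural_induction hvar happ t

theorem Term.subst_congr {σ τ : V → Term F V} (t : Term F V) :
    (∀ x ∈ t.varOccs, σ x = τ x) → t.subst σ = t.subst τ := by
  induction t using Term.structural_induction with
  | hvar x => intro h; simpa [Term.subst, Term.varOccs] using h
  | happ f ts ih =>
    intro h
    rw [Term.subst_app, Term.subst_app, List.map_congr_left]
    intro t ht
    refine ih t ht fun x hx => h x ?_
    rw [Term.varOccs_app]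
    exact List.mem_flatMap.2 ⟨t, ht, hx⟩

/-! ### Case analysis on rewrite steps -/

theorem Rew.rootStep_or_belowRew {s t : Term F V} (h : Rew R s t) :
    RootStep R s t ∨ BelowRew R s t := by
  cases h with
  | root h => exact .inl ⟨_, _, _, h, rfl, rfl⟩
  | congr h => exact .inr ⟨_, _, _, _, _, h, rfl, rfl⟩

theorem IRew.normal_or_belowRew {s t : Term F V} (h : IRew R s t) :
    (∀ u, PSub u s → NormalForm R u) ∨ IBelowRew R s t := by
  cases h with
  | root _ h => exact .inl h
  | congr h => exact .inr ⟨_, _, _, _, _, h, rfl, rfl⟩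

theorem IRew.rew {s t : Term F V} (h : IRew R s t) : Rew R s t := by
  induction h with
  | root h _ => exact .root h
  | congr _ ih => exact .congr ih

/-! ### Normal forms -/

theorem NormalForm.of_mem {f : F} {ts : List (Term F V)} (h : NormalForm R (.app f ts))
    {t : Term F V} (ht : t ∈ ts) : NormalForm R t := by
  intro u hu
  obtain ⟨as, bs, rfl⟩ := List.append_of_mem ht
  exact h _ (.congr hu)

theorem NormalForm.of_pSub {s u : Term F V} (hu : PSub u s) :
    NormalForm R s → NormalForm R u := by
  induction hu with
  | head ht => exact fun h => h.of_mem ht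
  | tail _ ht ih => exact fun h => ih (h.of_mem ht)

theorem normalForm_of_pSub_app {f : F} {ts : List (Term F V)}
    (h : ∀ t ∈ ts, NormalForm R t) {u : Term F V} (hu : PSub u (.app f ts)) :
    NormalForm R u := by
  cases hu with
  | head ht => exact h _ ht
  | tail hu ht => exact (h _ ht).of_pSub hu

theorem normalForm_app {f : F} {ts : List (Term F V)} (h : ∀ t ∈ ts, NormalForm R t)
    (hroot : ∀ u, ¬ RootStep R (.app f ts) u) : NormalForm R (.app f ts) := by
  intro u hu
  obtain hu | ⟨g, as, bs, a, b, hab, he, -⟩ := hu.rootStep_or_belowRew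
  · exact hroot u hu
  · cases he
    exact h a (by simp) b hab

theorem exists_iRew_of_not_normalForm (s : Term F V) :
    ¬ NormalForm R s → ∃ t, IRew R s t := by
  induction s using Term.structural_induction with
  | hvar x =>
    intro h
    simp only [NormalForm, not_forall, not_not] at h
    obtain ⟨u, hu⟩ := h
    obtain ⟨l, r, σ, hlr, hs, -⟩ | ⟨f, as, bs, a, b, -, he, -⟩ := hu.rootStep_or_belowRew
    · refine ⟨r.subst σ, ?_⟩
      rw [hs]
      refine .root hlr fun v hv => ?_
      rw [← hs] at hv
      cases hv
    · cases he
  | happ f ts ih =>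
    intro h
    by_cases hts : ∀ t ∈ ts, NormalForm R t
    · have : ∃ u, RootStep R (.app f ts) u := by
        by_contra! hroot
        exact h (normalForm_app hts hroot)
      obtain ⟨u, l, r, σ, hlr, hs, -⟩ := this
      refine ⟨r.subst σ, ?_⟩
      rw [hs]
      exact .root hlr fun v hv => normalForm_of_pSub_app hts (hs ▸ hv)
    · push Not at hts
      obtain ⟨t, ht, hn⟩ := hts
      obtain ⟨u, hu⟩ := ih t ht hn
      obtain ⟨as, bs, rfl⟩ := List.append_of_mem ht
      exact ⟨_, .congr hu⟩

/-! ### Termination -/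

theorem Terminating.of_rew {s t : Term F V} (hs : Terminating R s) (h : Rew R s t) :
    Terminating R t := by
  rintro ⟨g, rfl, hg⟩
  exact hs ⟨fun n => n.casesOn s g, rfl, fun n => by cases n; exacts [h, hg _]⟩

theorem Terminating.of_mem {f : F} {ts : List (Term F V)} (h : Terminating R (.app f ts))
    {t : Term F V} (ht : t ∈ ts) : Terminating R t := by
  rintro ⟨g, rfl, hg⟩
  obtain ⟨as, bs, rfl⟩ := List.append_of_mem ht
  exact h ⟨fun n => .app f (as ++ g n :: bs), rfl, fun n => .congr (hg n)⟩

theorem Terminating.of_subst {σ : V → Term F V} {x : V} (t : Term F V) :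
    x ∈ t.varOccs → Terminating R (t.subst σ) → Terminating R (σ x) := by
  induction t using Term.structural_induction with
  | hvar y =>
    intro hx h
    rw [Term.varOccs, List.mem_singleton] at hx
    rwa [Term.subst, ← hx] at h
  | happ f ts ih =>
    intro hx h
    rw [Term.varOccs_app] at hx
    obtain ⟨t, ht, hx⟩ := List.mem_flatMap.1 hx
    rw [Term.subst_app] at h
    exact ih t ht hx (h.of_mem (List.mem_map_of_mem ht))

theorem Terminating.exists_normalForm {s : Term F V} (hs : Terminating R s) :
    ∃ t, ReflTransGen (IRew R) s t ∧ NormalForm R t := by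
  by_contra! hno
  have hstep : ∀ u : {u // ReflTransGen (IRew R) s u},
      ∃ v : {u // ReflTransGen (IRew R) s u}, IRew R u.1 v.1 := fun u =>
    let ⟨v, hv⟩ := exists_iRew_of_not_normalForm u.1 (hno _ u.2)
    ⟨⟨v, u.2.tail hv⟩, hv⟩
  choose next hnext using hstep
  refine hs ⟨fun n => (next^[n] ⟨s, .refl⟩).1, rfl, fun n => ?_⟩
  simp only [Function.iterate_succ_apply']
  exact (hnext _).rew

/-! ### Innermost rewriting in contexts and under substitutions -/

theorem reflTransGen_iRew_congr (f : F) (as bs : List (Term F V)) {s t : Term F V}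
    (h : ReflTransGen (IRew R) s t) :
    ReflTransGen (IRew R) (.app f (as ++ s :: bs)) (.app f (as ++ t :: bs)) :=
  ReflTransGen.lift (p := IRew R) (fun u => Term.app f (as ++ u :: bs))
    (fun _ _ h => IRew.congr h) _ _ h

theorem reflTransGen_iRew_app (f : F) {ts us : List (Term F V)}
    (h : List.Forall₂ (ReflTransGen (IRew R)) ts us) (as : List (Term F V)) :
    ReflTransGen (IRew R) (.app f (as ++ ts)) (.app f (as ++ us)) := by
  induction h generalizing as with
  | nil => exact .refl
  | @cons a b ts us hab _ ih =>
    refine (reflTransGen_iRew_congr f as ts hab).trans ?_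
    simpa using ih (as ++ [b])

theorem reflTransGen_iRew_subst {σ τ : V → Term F V} (t : Term F V) :
    (∀ x ∈ t.varOccs, ReflTransGen (IRew R) (σ x) (τ x)) →
      ReflTransGen (IRew R) (t.subst σ) (t.subst τ) := by
  induction t using Term.structural_induction with
  | hvar x => intro h; simpa [Term.subst, Term.varOccs] using h
  | happ f ts ih =>
    intro h
    rw [Term.subst_app, Term.subst_app]
    refine reflTransGen_iRew_app f ?_ []
    rw [List.forall₂_map_left_iff, List.forall₂_map_right_iff, List.forall₂_same]
    intro t ht
    refine ih t ht fun x hx => h x ?_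
    rw [Term.varOccs_app]
    exact List.mem_flatMap.2 ⟨t, ht, hx⟩

theorem exists_forall₂_of_forall₂_append {α β : Type*} {r : α → β → Prop} {as bs : List α}
    {us : List β} (h : List.Forall₂ r (as ++ bs) us) :
    ∃ vs ws, List.Forall₂ r as vs ∧ List.Forall₂ r bs ws ∧ us = vs ++ ws := by
  induction as generalizing us with
  | nil => exact ⟨[], us, .nil, h, rfl⟩
  | cons a as ih =>
    cases h with
    | cons ha h =>
      obtain ⟨vs, ws, hvs, hws, rfl⟩ := ih h
      exact ⟨_ :: vs, ws, .cons ha hvs, hws, rfl⟩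

/-- An innermost reduction to normal form can be reordered so that the arguments are
normalized first. -/
theorem exists_normalForm_args {f : F} {ts : List (Term F V)} {t : Term F V}
    (h : ReflTransGen (IRew R) (.app f ts) t) (ht : NormalForm R t) :
    ∃ us, List.Forall₂ (ReflTransGen (IRew R)) ts us ∧ (∀ u ∈ us, NormalForm R u) ∧
      ReflTransGen (IRew R) (.app f us) t := by
  generalize hs : Term.app f ts = s at h
  induction h using ReflTransGen.head_induction_on generalizing ts with
  | refl =>
    subst hs
    exact ⟨ts, List.forall₂_same.2 fun _ _ => .refl, fun _ hu => ht.of_mem hu, .refl⟩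
  | head hstep hrest ih =>
    subst hs
    obtain hn | ⟨g, as, bs, a, b, hab, he, rfl⟩ := hstep.normal_or_belowRew
    · exact ⟨ts, List.forall₂_same.2 fun _ _ => .refl, fun u hu => hn u (.head hu),
        hrest.head hstep⟩
    · cases he
      obtain ⟨us, hus, hnf, hred⟩ := ih rfl
      refine ⟨us, ?_, hnf, hred⟩
      obtain ⟨vs, ws, hvs, hws, rfl⟩ := exists_forall₂_of_forall₂_append hus
      cases hws with
      | cons hb hws => exact List.rel_append hvs (.cons (hb.head hab) hws)

theorem exists_normalizing_subst_list {σ : V → Term F V} {ts : List (Term F V)}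
    (ih : ∀ t ∈ ts, t.Linear → ∀ u, ReflTransGen (IRew R) (t.subst σ) u → NormalForm R u →
      ∃ τ : V → Term F V, (∀ x ∈ t.varOccs, ReflTransGen (IRew R) (σ x) (τ x) ∧
        NormalForm R (τ x)) ∧ ReflTransGen (IRew R) (t.subst τ) u)
    (hlin : (ts.flatMap Term.varOccs).Nodup) {us : List (Term F V)}
    (hred : List.Forall₂ (ReflTransGen (IRew R)) (ts.map (Term.subst σ)) us)
    (hnf : ∀ u ∈ us, NormalForm R u) :
    ∃ τ : V → Term F V, (∀ x ∈ ts.flatMap Term.varOccs, ReflTransGen (IRew R) (σ x) (τ x) ∧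
      NormalForm R (τ x)) ∧
      List.Forall₂ (ReflTransGen (IRew R)) (ts.map (Term.subst τ)) us := by
  classical
  induction ts generalizing us with
  | nil => cases hred; exact ⟨σ, by simp, .nil⟩
  | cons t ts ihl =>
    rw [List.map_cons] at hred
    cases hred with
    | @cons _ u _ us htu hred =>
    rw [List.flatMap_cons, List.nodup_append'] at hlin
    obtain ⟨hlt, hlts, hdisj⟩ := hlin
    obtain ⟨τ₁, h₁, hr₁⟩ := ih t (by simp) hlt u htu (hnf u (by simp))
    obtain ⟨τ₂, h₂, hr₂⟩ := ihl (fun v hv => ih v (List.mem_cons_of_mem _ hv)) hlts hred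
      fun w hw => hnf w (List.mem_cons_of_mem _ hw)
    refine ⟨fun x => if x ∈ t.varOccs then τ₁ x else τ₂ x, fun x hx => ?_, .cons ?_ ?_⟩
    · rw [List.flatMap_cons, List.mem_append] at hx
      dsimp only
      split_ifs with h
      · exact h₁ x h
      · exact h₂ x (hx.resolve_left h)
    · rwa [Term.subst_congr (τ := τ₁) t fun x hx => if_pos hx]
    · rwa [List.map_congr_left (g := Term.subst τ₂)]
      intro v hv
      refine Term.subst_congr v fun x hx => if_neg fun h => hdisj h ?_
      exact List.mem_flatMap.2 ⟨v, hv, hx⟩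

/-- An innermost reduction to normal form from an instance of a linear term can be reordered
so that the substitution is normalized first. -/
theorem exists_normalizing_subst {σ : V → Term F V} (r : Term F V) :
    r.Linear → ∀ t, ReflTransGen (IRew R) (r.subst σ) t → NormalForm R t →
      ∃ τ : V → Term F V, (∀ x ∈ r.varOccs, ReflTransGen (IRew R) (σ x) (τ x) ∧
        NormalForm R (τ x)) ∧ ReflTransGen (IRew R) (r.subst τ) t := by
  induction r using Term.structural_induction with
  | hvar x =>
    intro _ t h ht
    rw [Term.subst] at h
    refine ⟨fun _ => t, fun y hy => ?_, by rw [Term.subst]⟩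
    rw [Term.varOccs, List.mem_singleton] at hy
    exact hy ▸ ⟨h, ht⟩
  | happ f ts ih =>
    intro hlin t h ht
    rw [Term.Linear, Term.varOccs_app] at hlin
    rw [Term.subst_app] at h
    obtain ⟨us, hus, hnf, hred⟩ := exists_normalForm_args h ht
    obtain ⟨τ, hτ, hτus⟩ := exists_normalizing_subst_list ih hlin hus hnf
    refine ⟨τ, by rwa [Term.varOccs_app], ?_⟩
    rw [Term.subst_app]
    exact (reflTransGen_iRew_app f hτus []).trans hred

/-! ### Overlay systems -/

theorem normalForm_subst {σ : V → Term F V} (t : Term F V) :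
    (∀ x ∈ t.varOccs, NormalForm R (σ x)) →
    (∀ u, Sub u t → ¬ u.IsVar → ∀ v, ¬ RootStep R (u.subst σ) v) →
    NormalForm R (t.subst σ) := by
  induction t using Term.structural_induction with
  | hvar x => intro h _; simpa [Term.subst, Term.varOccs] using h
  | happ f ts ih =>
    intro hσ hroot
    have hself := hroot _ (.inl rfl) (by simp [Term.IsVar])
    rw [Term.subst_app] at hself ⊢
    refine normalForm_app ?_ hself
    simp only [List.mem_map, forall_exists_index, and_imp, forall_apply_eq_imp_iff₂]
    intro t ht
    refine ih t ht (fun x hx => hσ x ?_) fun u hu => hroot u (.inr ?_)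
    · rw [Term.varOccs_app]
      exact List.mem_flatMap.2 ⟨t, ht, hx⟩
    · obtain rfl | hu := hu
      exacts [.head ht, .tail hu ht]

theorem Overlay.normalForm_of_pSub (hOV : Overlay R) {l r : Term F V} (hlr : (l, r) ∈ R)
    (hl : ¬ l.IsVar) {σ : V → Term F V} (hσ : ∀ x ∈ l.varOccs, NormalForm R (σ x))
    {u : Term F V} (hu : PSub u (l.subst σ)) : NormalForm R u := by
  cases l with
  | var x => exact absurd trivial hl
  | app f ts =>
    rw [Term.subst_app] at hu
    refine normalForm_of_pSub_app ?_ hu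
    simp only [List.mem_map, forall_exists_index, and_imp, forall_apply_eq_imp_iff₂]
    intro t ht
    refine normalForm_subst t (fun x hx => hσ x ?_) ?_
    · rw [Term.varOccs_app]
      exact List.mem_flatMap.2 ⟨t, ht, hx⟩
    · rintro w hw hwv v ⟨l', r', τ, hlr', he, -⟩
      refine hOV ⟨_, r, l', r', w, hlr, hlr', ?_, hwv, σ, τ, he⟩
      obtain rfl | hw := hw
      exacts [.head ht, .tail hw ht]

/-- A rewrite step followed by an innermost reduction to normal form can be replaced by an
innermost reduction. -/
theorem Rew.reflTransGen_iRew (hTRS : IsTRS R) (hRL : RightLinear R) (hOV : Overlay R)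
    {s s' : Term F V} (h : Rew R s s') : Terminating R s →
      ∀ t, ReflTransGen (IRew R) s' t → NormalForm R t → ReflTransGen (IRew R) s t := by
  classical
  induction h with
  | @root l r σ hlr =>
    intro hs t h ht
    obtain ⟨τ, hτ, hred⟩ := exists_normalizing_subst r (hRL _ hlr) t h ht
    have hσ : ∀ x, ∃ u, x ∈ l.varOccs →
        (x ∈ r.varOccs → u = τ x) ∧ ReflTransGen (IRew R) (σ x) u ∧ NormalForm R u := by
      intro x
      by_cases hx : x ∈ r.varOccs
      · exact ⟨τ x, fun _ => ⟨fun _ => rfl, hτ x hx⟩⟩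
      · by_cases hxl : x ∈ l.varOccs
        · obtain ⟨u, hu⟩ := (hs.of_subst l hxl).exists_normalForm
          exact ⟨u, fun _ => ⟨fun h => absurd h hx, hu⟩⟩
        · exact ⟨σ x, fun h => absurd h hxl⟩
    choose ρ hρ using hσ
    have hstep : IRew R (l.subst ρ) (r.subst ρ) :=
      .root hlr fun u hu => hOV.normalForm_of_pSub hlr (hTRS _ hlr).1
        (fun x hx => (hρ x hx).2.2) hu
    have heq : r.subst ρ = r.subst τ :=
      Term.subst_congr r fun x hx => (hρ x ((hTRS _ hlr).2 x hx)).1 hx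
    rw [heq] at hstep
    exact (reflTransGen_iRew_subst l fun x hx => (hρ x hx).2.1).trans (hred.head hstep)
  | @congr a b f as bs _ ih =>
    intro hs t h ht
    obtain ⟨us, hus, hnf, hred⟩ := exists_normalForm_args h ht
    obtain ⟨vs, ws, hvs, hws, rfl⟩ := exists_forall₂_of_forall₂_append hus
    cases hws with
    | @cons _ w _ ws hw hws =>
      have ha := ih (hs.of_mem (by simp)) w hw (hnf w (by simp))
      exact (reflTransGen_iRew_app f (List.rel_append hvs (.cons ha hws)) []).trans hred

end RWS

namespace RWS

/-- Let `R` be a right-linear overlay TRS and `s` a term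
terminating w.r.t. `R`. If `s →_R* t` and `t` is a normal form of `R`,
then `s i→_R* t`. -/
theorem rewrite_to_nf_innermost_of_terminating_term
    {F V : Type} {R : Set (Term F V × Term F V)}
    (hTRS : IsTRS R) (hRL : RightLinear R) (hOV : Overlay R)
    (s : Term F V) (hsSN : Terminating R s) :
    ∀ t : Term F V, Relation.ReflTransGen (Rew R) s t → NormalForm R t →
      Relation.ReflTransGen (IRew R) s t := by
  intro t h ht
  induction h using Relation.ReflTransGen.head_induction_on with
  | refl => exact .refl
  | head hstep _ ih =>
    exact hstep.reflTransGen_iRew hTRS hRL hOV hsSN t (ih (hsSN.of_rew hstep)) ht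

end RWS
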